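/- For every d ∈ [0,1] and every integer n ≥ 1, C_n(d) − log₂(n+1)/n ≤ C(d) ≤ C_n(d). -/

import Mathlib

open scoped BigOperators

noncomputable section

/-- Output alphabet of the binary deletion channel with `n` input bits:
a length `k ≤ n` together with a binary string of that length. -/
abbrev DelOut (n : ℕ) := Σ k : Fin (n + 1), (Fin (k : ℕ) → Bool)

/-- The subsequence of `x` indexed by `S` (taken in increasing order),
as an element of `DelOut n`. -/
def restrictSub {n : ℕ} (x : Fin n → Bool) (S : Finset (Fin n)) : DelOut n :=
  ⟨⟨S.card, Nat.lt_succ_of_le (by simpa using Finset.card_le_univ S)⟩,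
   fun i => x (S.orderEmbOfFin rfl i)⟩

/-- Transition probability of the binary deletion channel `W_n^d`: each input bit is
deleted independently with probability `d`. -/
def delW {n : ℕ} (d : ℝ) (x : Fin n → Bool) (y : DelOut n) : ℝ :=
  ∑ S : Finset (Fin n),
    if restrictSub x S = y then (1 - d) ^ S.card * d ^ (n - S.card) else 0

/-- Transition probability of the exact deletion channel `W_{n,k}`, which keeps exactly `k`
of the `n` input bits, the kept positions being a uniformly random `k`-subset; `k`-subsets
are identified with strictly monotone maps `Fin k → Fin n`. -/
def exactW {n k : ℕ} (x : Fin n → Bool) (y : Fin k → Bool) : ℝ :=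
  ((Finset.univ.filter fun f : Fin k → Fin n => StrictMono f ∧ x ∘ f = y).card : ℝ) /
    (n.choose k : ℝ)

/-- `p` is a probability distribution on the finite alphabet `α`. -/
def IsDist {α : Type*} [Fintype α] (p : α → ℝ) : Prop :=
  (∀ a, 0 ≤ p a) ∧ ∑ a, p a = 1

/-- Base-2 mutual information `I(X;Y)` between the input `X ~ p` and the output `Y`
of the channel with transition matrix `W`. -/
def mutualInfo {α β : Type*} [Fintype α] [Fintype β] (p : α → ℝ) (W : α → β → ℝ) : ℝ :=
  ∑ x, ∑ y, p x * W x y * Real.logb 2 (W x y / ∑ x', p x' * W x' y)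

/-- `C_n(d) = (1/n) · sup_p I(X ; W_n^d(X))`. -/
def Cn (n : ℕ) (d : ℝ) : ℝ :=
  (1 / (n : ℝ)) * ⨆ p : {p : (Fin n → Bool) → ℝ // IsDist p}, mutualInfo p.1 (delW d)

/-- `C_{n,k} = (1/n) · sup_p I(X ; W_{n,k}(X))`. -/
def Cnk (n k : ℕ) : ℝ :=
  (1 / (n : ℝ)) * ⨆ p : {p : (Fin n → Bool) → ℝ // IsDist p},
    mutualInfo p.1 (exactW (n := n) (k := k))

/-- Capacity of the binary deletion channel: `C(d) = inf_{n ≥ 1} C_n(d)`. -/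
def C (d : ℝ) : ℝ := ⨅ n : {m : ℕ // 1 ≤ m}, Cn n d

/-! ### The log-sum inequality -/

theorem log_sum_inequality {ι : Type*} (s : Finset ι) (a b : ι → ℝ)
    (ha : ∀ i ∈ s, 0 ≤ a i) (hb : ∀ i ∈ s, 0 ≤ b i) (hab : ∀ i ∈ s, b i = 0 → a i = 0) :
    (∑ i ∈ s, a i) * Real.logb 2 ((∑ i ∈ s, a i) / ∑ i ∈ s, b i) ≤
      ∑ i ∈ s, a i * Real.logb 2 (a i / b i) := by
  rcases (Finset.sum_nonneg ha).eq_or_lt with hA | hA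
  · have h0 := (Finset.sum_eq_zero_iff_of_nonneg ha).1 hA.symm
    rw [← hA, zero_mul]
    exact (Finset.sum_eq_zero fun i hi => by rw [h0 i hi, zero_mul]).ge
  have hB : 0 < ∑ i ∈ s, b i := by
    obtain ⟨i, hi, hai⟩ := Finset.exists_ne_zero_of_sum_ne_zero hA.ne'
    exact Finset.sum_pos' hb ⟨i, hi, (hb i hi).lt_of_ne' fun h => hai (hab i hi h)⟩
  set A := ∑ i ∈ s, a i with hAdef
  set B := ∑ i ∈ s, b i with hBdef
  have hlog2 : 0 < Real.log 2 := Real.log_pos one_lt_two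
  have key : ∀ i ∈ s, a i * Real.logb 2 (A / B) + (a i - b i * (A / B)) / Real.log 2 ≤
      a i * Real.logb 2 (a i / b i) := by
    intro i hi
    rcases (ha i hi).eq_or_lt with h | h
    · rw [← h]
      have : 0 ≤ b i * (A / B) := mul_nonneg (hb i hi) (by positivity)
      simp only [zero_mul, zero_add, zero_sub]
      exact div_nonpos_of_nonpos_of_nonneg (by linarith) hlog2.le
    · have hbi : 0 < b i := (hb i hi).lt_of_ne' fun h' => h.ne' (hab i hi h')
      have h1 := Real.one_sub_inv_le_log_of_pos (x := a i / b i / (A / B)) (by positivity)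
      rw [Real.log_div (by positivity) (by positivity)] at h1
      have h2 := mul_le_mul_of_nonneg_left h1 h.le
      have h3 : a i * (1 - (a i / b i / (A / B))⁻¹) = a i - b i * (A / B) := by
        field_simp
      rw [h3] at h2
      simp only [Real.logb]
      rw [mul_div_assoc', mul_div_assoc' _ (Real.log (a i / b i)), ← add_div]
      exact div_le_div_of_nonneg_right (by linarith) hlog2.le
  have hsum := Finset.sum_le_sum key
  rw [Finset.sum_add_distrib, ← Finset.sum_mul, ← Finset.sum_div, Finset.sum_sub_distrib,
    ← Finset.sum_mul, ← hAdef, ← hBdef, mul_div_cancel₀ _ hB.ne'] at hsum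
  simpa using hsum

/-! ### Mutual information over finite alphabets -/

section MutualInfo

variable {α α₁ α₂ β β₁ β₂ γ : Type*} [Fintype α]

/-- Law of the output of the channel `W` when the input has law `p`. -/
def outputDist (p : α → ℝ) (W : α → β → ℝ) (y : β) : ℝ := ∑ x, p x * W x y

theorem outputDist_nonneg {p : α → ℝ} {W : α → β → ℝ} (hp : ∀ x, 0 ≤ p x)
    (hW : ∀ x y, 0 ≤ W x y) (y : β) : 0 ≤ outputDist p W y :=
  Finset.sum_nonneg fun x _ => mul_nonneg (hp x) (hW x y)

theorem outputDist_pos {p : α → ℝ} {W : α → β → ℝ} (hp : ∀ x, 0 ≤ p x)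
    (hW : ∀ x y, 0 ≤ W x y) {x : α} {y : β} (hx : 0 < p x) (hxy : 0 < W x y) :
    0 < outputDist p W y :=
  Finset.sum_pos' (fun x _ => mul_nonneg (hp x) (hW x y))
    ⟨x, Finset.mem_univ x, mul_pos hx hxy⟩

variable [Fintype β] [Fintype β₁] [Fintype β₂]

theorem mutualInfo_eq (p : α → ℝ) (W : α → β → ℝ) :
    mutualInfo p W = ∑ x, ∑ y, p x * W x y * Real.logb 2 (W x y / outputDist p W y) := rfl

theorem sum_outputDist {p : α → ℝ} {W : α → β → ℝ} (hp : IsDist p) (hW : ∀ x, IsDist (W x)) :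
    ∑ y, outputDist p W y = 1 := by
  simp only [outputDist]
  rw [Finset.sum_comm]
  simp [← Finset.mul_sum, (hW _).2, hp.2]

/-- The channel `W` followed by the deterministic map `g`. -/
def mapChannel [DecidableEq γ] (g : β → γ) (W : α → β → ℝ) (x : α) (z : γ) : ℝ :=
  ∑ y with g y = z, W x y

theorem outputDist_mapChannel [DecidableEq γ] (g : β → γ) (p : α → ℝ) (W : α → β → ℝ) (z : γ) :
    outputDist p (mapChannel g W) z = ∑ y with g y = z, outputDist p W y := by
  simp only [outputDist, mapChannel, Finset.mul_sum]
  rw [Finset.sum_comm]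

/-- Independent parallel use of two channels. -/
def prodChannel (W₁ : α₁ → β₁ → ℝ) (W₂ : α₂ → β₂ → ℝ) (x : α₁ × α₂) (y : β₁ × β₂) : ℝ :=
  W₁ x.1 y.1 * W₂ x.2 y.2

theorem IsDist.prodChannel {W₁ : α₁ → β₁ → ℝ} {W₂ : α₂ → β₂ → ℝ}
    (hW₁ : ∀ x, IsDist (W₁ x)) (hW₂ : ∀ x, IsDist (W₂ x)) (x : α₁ × α₂) :
    IsDist (prodChannel W₁ W₂ x) :=
  ⟨fun y => mul_nonneg ((hW₁ x.1).1 y.1) ((hW₂ x.2).1 y.2), by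
    simp only [_root_.prodChannel, Fintype.sum_prod_type, ← Finset.mul_sum, (hW₂ _).2, (hW₁ _).2,
      mul_one]⟩

variable [Fintype γ] [Fintype α₁] [Fintype α₂]

/-- Data processing inequality for deterministic processing of the output. -/
theorem mutualInfo_mapChannel_le [DecidableEq γ] (g : β → γ) {p : α → ℝ} {W : α → β → ℝ}
    (hp : ∀ x, 0 ≤ p x) (hW : ∀ x y, 0 ≤ W x y) :
    mutualInfo p (mapChannel g W) ≤ mutualInfo p W := by
  rw [mutualInfo_eq, mutualInfo_eq]
  refine Finset.sum_le_sum fun x _ => ?_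
  simp only [mul_assoc, ← Finset.mul_sum]
  rcases (hp x).eq_or_lt with hx | hx
  · simp [← hx]
  refine mul_le_mul_of_nonneg_left ?_ (hp x)
  rw [← Finset.sum_fiberwise (s := Finset.univ) (g := g)
    (f := fun y => W x y * Real.logb 2 (W x y / outputDist p W y))]
  refine Finset.sum_le_sum fun z _ => ?_
  rw [outputDist_mapChannel]
  refine log_sum_inequality _ (W x) (outputDist p W) (fun y _ => hW x y)
    (fun y _ => outputDist_nonneg hp hW y) fun y _ hy => ?_
  by_contra h
  exact (outputDist_pos hp hW hx ((hW x y).lt_of_ne' h)).ne' hy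

/-- Processing the output by a map whose fibers have at most `K` elements loses at most
`log₂ K` bits of mutual information. -/
theorem mutualInfo_le_mapChannel_add [DecidableEq γ] (g : β → γ) {p : α → ℝ} {W : α → β → ℝ}
    (hp : IsDist p) (hW : ∀ x, IsDist (W x)) (K : ℕ)
    (hK : ∀ z, (Finset.univ.filter fun y => g y = z).card ≤ K) :
    mutualInfo p W ≤ mutualInfo p (mapChannel g W) + Real.logb 2 K := by
  set q := outputDist p W with hq
  set Q := outputDist p (mapChannel g W) with hQ
  have hW0 : ∀ x y, 0 ≤ W x y := fun x => (hW x).1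
  have hq0 : ∀ y, 0 ≤ q y := outputDist_nonneg hp.1 hW0
  have hV : ∀ x y, W x y ≤ mapChannel g W x (g y) := fun x y =>
    Finset.single_le_sum (f := W x) (fun y _ => hW0 x y) (by simp)
  have hV0 : ∀ x z, 0 ≤ mapChannel g W x z := fun x z => Finset.sum_nonneg fun y _ => hW0 x y
  have hmap : mutualInfo p (mapChannel g W) =
      ∑ x, ∑ y, p x * W x y * Real.logb 2 (mapChannel g W x (g y) / Q (g y)) := by
    rw [mutualInfo_eq]
    refine Finset.sum_congr rfl fun x _ => ?_
    rw [← Finset.sum_fiberwise (s := Finset.univ) (g := g)]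
    refine Finset.sum_congr rfl fun z _ => ?_
    rw [Finset.sum_congr rfl (fun y hy => by rw [(Finset.mem_filter.1 hy).2]), ← Finset.sum_mul,
      ← Finset.mul_sum]
    rfl
  have hterm : ∀ x y, p x * W x y * Real.logb 2 (W x y / q y) ≤
      p x * W x y * Real.logb 2 (mapChannel g W x (g y) / Q (g y)) +
        p x * W x y * Real.logb 2 (Q (g y) / q y) := by
    intro x y
    rcases (hp.1 x).eq_or_lt with hx | hx
    · simp [← hx]
    rcases (hW0 x y).eq_or_lt with hy | hy
    · simp [← hy]
    have h1 : 0 < q y := outputDist_pos hp.1 hW0 hx hy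
    have h2 : 0 < mapChannel g W x (g y) := hy.trans_le (hV x y)
    have h3 : 0 < Q (g y) := outputDist_pos hp.1 hV0 hx h2
    rw [← mul_add, ← Real.logb_mul (by positivity) (by positivity)]
    refine mul_le_mul_of_nonneg_left ?_ (by positivity)
    rw [div_mul_div_cancel₀ h3.ne']
    exact Real.logb_le_logb_of_le one_lt_two (by positivity) (by gcongr; exact hV x y)
  have hrest : ∑ x, ∑ y, p x * W x y * Real.logb 2 (Q (g y) / q y) ≤ Real.logb 2 K := by
    rw [Finset.sum_comm]
    simp only [← Finset.sum_mul]
    change ∑ y, q y * Real.logb 2 (Q (g y) / q y) ≤ _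
    rw [← Finset.sum_fiberwise (s := Finset.univ) (g := g)]
    have hfib : ∀ z, ∑ y with g y = z, q y * Real.logb 2 (Q (g y) / q y) ≤
        Q z * Real.logb 2 K := by
      intro z
      have hQz : Q z = ∑ y with g y = z, q y := outputDist_mapChannel g p W z
      have hls := log_sum_inequality (Finset.univ.filter fun y => g y = z) q (fun _ => 1)
        (fun y _ => hq0 y) (fun _ _ => zero_le_one) (fun _ _ h => absurd h one_ne_zero)
      rw [← hQz] at hls
      simp only [Finset.sum_const, nsmul_eq_mul, mul_one, div_one] at hls
      have hQ0 : 0 ≤ Q z := outputDist_nonneg hp.1 hV0 z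
      rcases hQ0.eq_or_lt with h0 | h0
      · rw [← h0, zero_mul]
        have hall := (Finset.sum_eq_zero_iff_of_nonneg fun y _ => hq0 y).1 (hQz.symm.trans h0.symm)
        exact (Finset.sum_eq_zero fun y hy => by rw [hall y hy, zero_mul]).le
      have hcard : 0 < (Finset.univ.filter fun y => g y = z).card := by
        rw [Finset.card_pos]
        by_contra h
        rw [Finset.not_nonempty_iff_eq_empty] at h
        rw [hQz, h, Finset.sum_empty] at h0
        exact h0.false
      have hcard' : (0 : ℝ) < (Finset.univ.filter fun y => g y = z).card := by
        exact_mod_cast hcard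
      rw [Real.logb_div h0.ne' hcard'.ne'] at hls
      have hsplit : ∑ y with g y = z, q y * Real.logb 2 (Q (g y) / q y) =
          Q z * Real.logb 2 (Q z) - ∑ y with g y = z, q y * Real.logb 2 (q y) := by
        conv_rhs => rw [show Q z * Real.logb 2 (Q z) = ∑ y with g y = z, q y * Real.logb 2 (Q z) by
          rw [← Finset.sum_mul, ← hQz]]
        rw [← Finset.sum_sub_distrib]
        refine Finset.sum_congr rfl fun y hy => ?_
        rw [(Finset.mem_filter.1 hy).2]
        rcases (hq0 y).eq_or_lt with h | h
        · simp [← h]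
        · rw [Real.logb_div h0.ne' h.ne', mul_sub]
      have hmono : Real.logb 2 (Finset.univ.filter fun y => g y = z).card ≤ Real.logb 2 K :=
        Real.logb_le_logb_of_le one_lt_two hcard' (by exact_mod_cast hK z)
      rw [hsplit]
      nlinarith [mul_le_mul_of_nonneg_left hmono hQ0]
    refine (Finset.sum_le_sum fun z _ => hfib z).trans ?_
    rw [← Finset.sum_mul]
    have hQ1 : ∑ z, Q z = 1 := by
      simp only [hQ, outputDist_mapChannel]
      rw [Finset.sum_fiberwise, sum_outputDist hp hW]
    rw [hQ1, one_mul]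
  rw [mutualInfo_eq, hmap]
  refine (Finset.sum_le_sum fun x _ => Finset.sum_le_sum fun y _ => hterm x y).trans ?_
  simp only [Finset.sum_add_distrib]
  linarith

theorem mutualInfo_le_logb_card {p : α → ℝ} {W : α → β → ℝ}
    (hp : IsDist p) (hW : ∀ x, IsDist (W x)) :
    mutualInfo p W ≤ Real.logb 2 (Fintype.card β) := by
  have h := mutualInfo_le_mapChannel_add (fun _ : β => ()) hp hW (Fintype.card β)
    fun _ => Finset.card_le_univ _
  have h1 : mapChannel (fun _ : β => ()) W = fun _ _ => 1 := by
    funext x z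
    simp [mapChannel, (hW x).2]
  have h0 : mutualInfo p (mapChannel (fun _ : β => ()) W) = 0 := by
    simp [h1, mutualInfo, hp.2]
  linarith

/-- Chain rule for a product channel: the mutual information is the sum of those of the two
components minus the mutual information between the two outputs. -/
theorem mutualInfo_prodChannel {p : α₁ × α₂ → ℝ} {W₁ : α₁ → β₁ → ℝ} {W₂ : α₂ → β₂ → ℝ}
    (hp : ∀ x, 0 ≤ p x) (hW₁ : ∀ x, IsDist (W₁ x)) (hW₂ : ∀ x, IsDist (W₂ x)) :
    mutualInfo p (prodChannel W₁ W₂) =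
      mutualInfo (fun a => ∑ b, p (a, b)) W₁ + mutualInfo (fun b => ∑ a, p (a, b)) W₂ -
        ∑ y : β₁ × β₂, outputDist p (prodChannel W₁ W₂) y *
          Real.logb 2 (outputDist p (prodChannel W₁ W₂) y /
            (outputDist (fun a => ∑ b, p (a, b)) W₁ y.1 *
              outputDist (fun b => ∑ a, p (a, b)) W₂ y.2)) := by
  set p₁ : α₁ → ℝ := fun a => ∑ b, p (a, b) with hp₁
  set p₂ : α₂ → ℝ := fun b => ∑ a, p (a, b) with hp₂
  set q := outputDist p (prodChannel W₁ W₂) with hq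
  set q₁ := outputDist p₁ W₁ with hq₁
  set q₂ := outputDist p₂ W₂ with hq₂
  have hp₁0 : ∀ a, 0 ≤ p₁ a := fun a => Finset.sum_nonneg fun b _ => hp _
  have hp₂0 : ∀ b, 0 ≤ p₂ b := fun a => Finset.sum_nonneg fun b _ => hp _
  have hterm : ∀ (x : α₁ × α₂) (y : β₁ × β₂),
      p x * prodChannel W₁ W₂ x y * Real.logb 2 (prodChannel W₁ W₂ x y / q y) =
      p x * prodChannel W₁ W₂ x y * Real.logb 2 (W₁ x.1 y.1 / q₁ y.1) +
      p x * prodChannel W₁ W₂ x y * Real.logb 2 (W₂ x.2 y.2 / q₂ y.2) -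
      p x * prodChannel W₁ W₂ x y * Real.logb 2 (q y / (q₁ y.1 * q₂ y.2)) := by
    intro x y
    rcases (hp x).eq_or_lt with hx | hx
    · simp [← hx]
    rcases ((hW₁ x.1).1 y.1).eq_or_lt with h1 | h1
    · simp [prodChannel, ← h1]
    rcases ((hW₂ x.2).1 y.2).eq_or_lt with h2 | h2
    · simp [prodChannel, ← h2]
    have hx1 : 0 < p₁ x.1 :=
      Finset.sum_pos' (fun b _ => hp _) ⟨x.2, Finset.mem_univ _, hx⟩
    have hx2 : 0 < p₂ x.2 :=
      Finset.sum_pos' (fun b _ => hp _) ⟨x.1, Finset.mem_univ _, hx⟩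
    have hqp : 0 < q y := outputDist_pos hp
      (fun x => (IsDist.prodChannel hW₁ hW₂ x).1) hx (mul_pos h1 h2)
    have hq1p : 0 < q₁ y.1 := outputDist_pos hp₁0 (fun x => (hW₁ x).1) hx1 h1
    have hq2p : 0 < q₂ y.2 := outputDist_pos hp₂0 (fun x => (hW₂ x).1) hx2 h2
    rw [← mul_add, ← mul_sub]
    congr 1
    rw [prodChannel, Real.logb_div (by positivity) (by positivity),
      Real.logb_div (by positivity) (by positivity),
      Real.logb_div (by positivity) (by positivity),
      Real.logb_div (by positivity) (by positivity), Real.logb_mul (by positivity) (by positivity),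
      Real.logb_mul (by positivity) (by positivity)]
    ring
  rw [mutualInfo_eq]
  simp only [← hq, hterm, Finset.sum_sub_distrib, Finset.sum_add_distrib]
  congr 1
  · congr 1
    · rw [mutualInfo_eq, Fintype.sum_prod_type]
      refine Finset.sum_congr rfl fun a _ => ?_
      simp only [Fintype.sum_prod_type, prodChannel]
      rw [Finset.sum_comm]
      refine Finset.sum_congr rfl fun u _ => ?_
      simp only [hp₁, Finset.sum_mul]
      refine Finset.sum_congr rfl fun b _ => ?_
      rw [← Finset.sum_mul, ← Finset.mul_sum, ← Finset.mul_sum, (hW₂ b).2, mul_one]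
    · rw [mutualInfo_eq, Fintype.sum_prod_type_right]
      refine Finset.sum_congr rfl fun b _ => ?_
      simp only [Fintype.sum_prod_type_right, prodChannel]
      rw [Finset.sum_comm]
      refine Finset.sum_congr rfl fun v _ => ?_
      simp only [hp₂, Finset.sum_mul]
      refine Finset.sum_congr rfl fun a _ => ?_
      rw [← Finset.sum_mul, ← Finset.mul_sum, ← Finset.sum_mul, (hW₁ a).2, one_mul]
  · rw [Finset.sum_comm]
    simp only [← Finset.sum_mul]
    rfl

theorem IsDist.marginal_fst {p : α₁ × α₂ → ℝ} (hp : IsDist p) :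
    IsDist fun a => ∑ b, p (a, b) :=
  ⟨fun _ => Finset.sum_nonneg fun _ _ => hp.1 _, by rw [← Fintype.sum_prod_type, hp.2]⟩

theorem IsDist.marginal_snd {p : α₁ × α₂ → ℝ} (hp : IsDist p) :
    IsDist fun b => ∑ a, p (a, b) :=
  ⟨fun _ => Finset.sum_nonneg fun _ _ => hp.1 _, by rw [← Fintype.sum_prod_type_right, hp.2]⟩

theorem IsDist.prod {p₁ : α₁ → ℝ} {p₂ : α₂ → ℝ} (hp₁ : IsDist p₁) (hp₂ : IsDist p₂) :
    IsDist fun x : α₁ × α₂ => p₁ x.1 * p₂ x.2 :=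
  ⟨fun x => mul_nonneg (hp₁.1 _) (hp₂.1 _), by
    simp only [Fintype.sum_prod_type, ← Finset.mul_sum, hp₂.2, hp₁.2, mul_one]⟩

theorem mutualInfo_prodChannel_le {p : α₁ × α₂ → ℝ} {W₁ : α₁ → β₁ → ℝ} {W₂ : α₂ → β₂ → ℝ}
    (hp : IsDist p) (hW₁ : ∀ x, IsDist (W₁ x)) (hW₂ : ∀ x, IsDist (W₂ x)) :
    mutualInfo p (prodChannel W₁ W₂) ≤
      mutualInfo (fun a => ∑ b, p (a, b)) W₁ + mutualInfo (fun b => ∑ a, p (a, b)) W₂ := by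
  rw [mutualInfo_prodChannel hp.1 hW₁ hW₂]
  set q := outputDist p (prodChannel W₁ W₂) with hq
  set q₁ := outputDist (fun a => ∑ b, p (a, b)) W₁ with hq₁
  set q₂ := outputDist (fun b => ∑ a, p (a, b)) W₂ with hq₂
  have hW := IsDist.prodChannel hW₁ hW₂
  have hq0 : ∀ y, 0 ≤ q y := outputDist_nonneg hp.1 fun x => (hW x).1
  have hq₁0 : ∀ y, 0 ≤ q₁ y := outputDist_nonneg hp.marginal_fst.1 fun x => (hW₁ x).1
  have hq₂0 : ∀ y, 0 ≤ q₂ y := outputDist_nonneg hp.marginal_snd.1 fun x => (hW₂ x).1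
  have hfst : ∀ u, ∑ v, q (u, v) = q₁ u := by
    intro u
    simp only [hq, hq₁, outputDist, prodChannel]
    rw [Finset.sum_comm, Fintype.sum_prod_type]
    refine Finset.sum_congr rfl fun a _ => ?_
    rw [Finset.sum_mul]
    refine Finset.sum_congr rfl fun b _ => ?_
    rw [← Finset.mul_sum, ← Finset.mul_sum, (hW₂ b).2, mul_one]
  have hsnd : ∀ v, ∑ u, q (u, v) = q₂ v := by
    intro v
    simp only [hq, hq₂, outputDist, prodChannel]
    rw [Finset.sum_comm, Fintype.sum_prod_type_right]
    refine Finset.sum_congr rfl fun b _ => ?_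
    rw [Finset.sum_mul]
    refine Finset.sum_congr rfl fun a _ => ?_
    rw [← Finset.mul_sum, ← Finset.sum_mul, (hW₁ a).2, one_mul]
  have hls := log_sum_inequality Finset.univ q (fun y => q₁ y.1 * q₂ y.2) (fun y _ => hq0 y)
    (fun y _ => mul_nonneg (hq₁0 _) (hq₂0 _)) fun y _ hy => by
      rcases mul_eq_zero.1 hy with h | h
      · rw [← hfst, Finset.sum_eq_zero_iff_of_nonneg fun _ _ => hq0 _] at h
        exact h y.2 (Finset.mem_univ _)
      · rw [← hsnd, Finset.sum_eq_zero_iff_of_nonneg fun _ _ => hq0 _] at h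
        exact h y.1 (Finset.mem_univ _)
  have hq1 : ∑ y, q y = 1 := sum_outputDist hp hW
  have hqq : ∑ y : β₁ × β₂, q₁ y.1 * q₂ y.2 = 1 := by
    simp only [Fintype.sum_prod_type, ← Finset.mul_sum]
    rw [← Finset.sum_mul, sum_outputDist hp.marginal_fst hW₁, sum_outputDist hp.marginal_snd hW₂,
      one_mul]
  rw [hq1, hqq] at hls
  simp only [div_one, Real.logb_one, mul_zero] at hls
  linarith

theorem mutualInfo_prodChannel_of_indep {p₁ : α₁ → ℝ} {p₂ : α₂ → ℝ} {W₁ : α₁ → β₁ → ℝ}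
    {W₂ : α₂ → β₂ → ℝ} (hp₁ : IsDist p₁) (hp₂ : IsDist p₂)
    (hW₁ : ∀ x, IsDist (W₁ x)) (hW₂ : ∀ x, IsDist (W₂ x)) :
    mutualInfo (fun x : α₁ × α₂ => p₁ x.1 * p₂ x.2) (prodChannel W₁ W₂) =
      mutualInfo p₁ W₁ + mutualInfo p₂ W₂ := by
  rw [mutualInfo_prodChannel (hp₁.prod hp₂).1 hW₁ hW₂]
  simp only [← Finset.mul_sum, ← Finset.sum_mul, hp₁.2, hp₂.2, mul_one, one_mul]
  have hq : ∀ y : β₁ × β₂, outputDist (fun x : α₁ × α₂ => p₁ x.1 * p₂ x.2) (prodChannel W₁ W₂) y =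
      outputDist p₁ W₁ y.1 * outputDist p₂ W₂ y.2 := by
    intro y
    simp only [outputDist, prodChannel, Fintype.sum_prod_type]
    rw [Finset.sum_mul_sum]
    exact Finset.sum_congr rfl fun a _ => Finset.sum_congr rfl fun b _ => by ring
  rw [sub_eq_self]
  refine Finset.sum_eq_zero fun y _ => ?_
  rw [hq]
  rcases eq_or_ne (outputDist p₁ W₁ y.1 * outputDist p₂ W₂ y.2) 0 with h | h
  · rw [h, zero_mul]
  · rw [div_self h, Real.logb_one, mul_zero]

theorem mutualInfo_comp_equiv (e : α₁ ≃ α) (p : α → ℝ) (W : α → β → ℝ) :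
    mutualInfo (p ∘ e) (W ∘ e) = mutualInfo p W := by
  have hq : ∀ y, ∑ x', (p ∘ e) x' * (W ∘ e) x' y = ∑ x', p x' * W x' y := fun y =>
    e.sum_comp fun x' => p x' * W x' y
  simp only [mutualInfo, hq]
  exact e.sum_comp fun x => ∑ y, p x * W x y * Real.logb 2 (W x y / ∑ x', p x' * W x' y)

theorem IsDist.comp_equiv {p : α → ℝ} (hp : IsDist p) (e : α₁ ≃ α) : IsDist (p ∘ e) :=
  ⟨fun _ => hp.1 _, (e.sum_comp p).trans hp.2⟩

end MutualInfo

/-! ### The deletion channel on concatenated inputs -/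

theorem delW_isDist {n : ℕ} {d : ℝ} (hd : d ∈ Set.Icc (0 : ℝ) 1) (x : Fin n → Bool) :
    IsDist (delW d x) := by
  have h1 : 0 ≤ 1 - d := sub_nonneg.2 hd.2
  have h0 : 0 ≤ d := hd.1
  refine ⟨fun y => Finset.sum_nonneg fun S _ => by split_ifs <;> positivity, ?_⟩
  simp only [delW]
  rw [Finset.sum_comm]
  simp [Fin.sum_pow_mul_eq_add_pow]

/-- The output string as a list. -/
def DelOut.toList {n : ℕ} (y : DelOut n) : List Bool := List.ofFn y.2

theorem DelOut.length_toList {n : ℕ} (y : DelOut n) : y.toList.length = y.1 := by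
  simp [DelOut.toList]

theorem DelOut.toList_injective (n : ℕ) : Function.Injective (DelOut.toList (n := n)) := by
  rintro ⟨k, f⟩ ⟨l, g⟩ h
  have hkl : k = l := Fin.ext (by simpa [DelOut.toList] using congrArg List.length h)
  subst hkl
  have hfg : f = g := List.ofFn_injective h
  rw [hfg]

/-- Concatenation of output strings. -/
def DelOut.append {a b : ℕ} (y : DelOut a × DelOut b) : DelOut (a + b) :=
  ⟨⟨y.1.1 + y.2.1, by have := y.1.1.2; have := y.2.1.2; omega⟩, Fin.append y.1.2 y.2.2⟩

theorem DelOut.toList_append {a b : ℕ} (y : DelOut a × DelOut b) :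
    (DelOut.append y).toList = y.1.toList ++ y.2.toList :=
  List.ofFn_fin_append _ _

theorem DelOut.card_fiber_append_le {a b : ℕ} (z : DelOut (a + b)) :
    (Finset.univ.filter fun y : DelOut a × DelOut b => DelOut.append y = z).card ≤ b + 1 := by
  conv_rhs => rw [← Finset.card_fin (b + 1)]
  refine Finset.card_le_card_of_injOn (fun y => y.2.1) (fun _ _ => Finset.mem_coe.2
    (Finset.mem_univ _)) ?_
  intro y hy y' hy' hlen
  simp only [Finset.coe_filter, Finset.mem_univ, true_and, Set.mem_ofPred_eq] at hy hy'
  have h := congrArg DelOut.toList (hy.trans hy'.symm)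
  rw [DelOut.toList_append, DelOut.toList_append] at h
  have hlen' : y.2.toList.length = y'.2.toList.length := by
    rw [DelOut.length_toList, DelOut.length_toList]
    exact congrArg Fin.val hlen
  obtain ⟨h1, h2⟩ := List.append_inj' h hlen'
  exact Prod.ext (DelOut.toList_injective a h1) (DelOut.toList_injective b h2)

theorem toList_restrictSub {n : ℕ} (x : Fin n → Bool) (S : Finset (Fin n)) :
    (restrictSub x S).toList = S.sort.map x := by
  rw [← Finset.listMap_orderEmbOfFin_finRange S rfl, List.map_map, ← List.ofFn_eq_map]
  rfl

/-- Subsets of `Fin (a + b)` as pairs of subsets of the two blocks. -/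
def finsetFinAddEquiv (a b : ℕ) : Finset (Fin a) × Finset (Fin b) ≃ Finset (Fin (a + b)) :=
  Finset.sumEquiv.symm.toEquiv.trans finSumFinEquiv.finsetCongr

theorem card_finsetFinAddEquiv {a b : ℕ} (S : Finset (Fin a) × Finset (Fin b)) :
    (finsetFinAddEquiv a b S).card = S.1.card + S.2.card := by
  simp [finsetFinAddEquiv]

theorem sort_finsetFinAddEquiv {a b : ℕ} (S : Finset (Fin a) × Finset (Fin b)) :
    (finsetFinAddEquiv a b S).sort =
      S.1.sort.map (Fin.castAdd b) ++ S.2.sort.map (Fin.natAdd a) := by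
  have hlt : (S.1.sort.map (Fin.castAdd b) ++ S.2.sort.map (Fin.natAdd a)).Pairwise (· < ·) := by
    rw [List.pairwise_append]
    refine ⟨List.Pairwise.map _ (fun i j h => Fin.lt_def.2 h) S.1.sortedLT_sort.pairwise,
      List.Pairwise.map _ (fun i j h => by simpa using h) S.2.sortedLT_sort.pairwise, ?_⟩
    simp only [List.mem_map]
    rintro _ ⟨i, -, rfl⟩ _ ⟨j, -, rfl⟩
    exact Fin.lt_def.2 (by simp only [Fin.val_castAdd, Fin.val_natAdd]; omega)
  refine List.Perm.eq_of_pairwise' (r := (· < ·)) (Finset.sortedLT_sort _).pairwise hlt ?_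
  rw [List.perm_ext_iff_of_nodup (Finset.sort_nodup _ _) (hlt.imp ne_of_lt)]
  intro i
  refine Fin.addCases (fun j => ?_) (fun j => ?_) i
  · have hne : ∀ k : Fin b, Fin.natAdd a k ≠ Fin.castAdd b j := fun k h => by
      have := congrArg Fin.val h
      simp only [Fin.val_castAdd, Fin.val_natAdd] at this
      omega
    simp [finsetFinAddEquiv, hne]
  · have hne : ∀ k : Fin a, Fin.castAdd b k ≠ Fin.natAdd a j := fun k h => by
      have := congrArg Fin.val h
      simp only [Fin.val_castAdd, Fin.val_natAdd] at this
      omega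
    simp [finsetFinAddEquiv, hne]

theorem restrictSub_append {a b : ℕ} (x : Fin a → Bool) (x' : Fin b → Bool)
    (S : Finset (Fin a) × Finset (Fin b)) :
    restrictSub (Fin.append x x') (finsetFinAddEquiv a b S) =
      DelOut.append (restrictSub x S.1, restrictSub x' S.2) := by
  apply DelOut.toList_injective
  rw [DelOut.toList_append, toList_restrictSub, toList_restrictSub, toList_restrictSub,
    sort_finsetFinAddEquiv, List.map_append, List.map_map, List.map_map]
  congr 2 <;> funext i <;> simp

theorem delW_append {a b : ℕ} (d : ℝ) :
    delW d ∘ Fin.appendEquiv a b =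
      mapChannel DelOut.append (prodChannel (delW (n := a) d) (delW (n := b) d)) := by
  funext x z
  simp only [Function.comp_apply, mapChannel, prodChannel, delW, Finset.sum_mul_sum]
  have hx : Fin.appendEquiv a b x = Fin.append x.1 x.2 := rfl
  rw [← (finsetFinAddEquiv a b).sum_comp, Fintype.sum_prod_type, Finset.sum_comm
    (s := Finset.univ.filter fun y : DelOut a × DelOut b => DelOut.append y = z)]
  refine Finset.sum_congr rfl fun S _ => ?_
  rw [Finset.sum_comm]
  refine Finset.sum_congr rfl fun T _ => ?_
  have hS : S.card ≤ a := by simpa using Finset.card_le_univ S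
  have hT : T.card ≤ b := by simpa using Finset.card_le_univ T
  rw [hx, restrictSub_append, card_finsetFinAddEquiv, Finset.sum_filter,
    Finset.sum_eq_single (restrictSub x.1 S, restrictSub x.2 T)]
  · rw [if_pos rfl, if_pos rfl, show a + b - (S.card + T.card) = (a - S.card) + (b - T.card) by omega,
      pow_add, pow_add, mul_mul_mul_comm]
  · intro y _ hy
    have : ¬(restrictSub x.1 S = y.1 ∧ restrictSub x.2 T = y.2) := fun h =>
      hy (Prod.ext h.1.symm h.2.symm)
    split_ifs <;> simp_all
  · simp

/-- The unnormalized capacity of `n` uses of the deletion channel. -/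
def blockCapacity (n : ℕ) (d : ℝ) : ℝ :=
  ⨆ p : {p : (Fin n → Bool) → ℝ // IsDist p}, mutualInfo p.1 (delW d)

instance (n : ℕ) : Nonempty {p : (Fin n → Bool) → ℝ // IsDist p} :=
  ⟨⟨Pi.single (fun _ => false) 1, fun x => by
    rw [Pi.single_apply]
    split_ifs <;> norm_num, by simp⟩⟩

theorem mutualInfo_le_blockCapacity {n : ℕ} {d : ℝ} (hd : d ∈ Set.Icc (0 : ℝ) 1)
    {p : (Fin n → Bool) → ℝ} (hp : IsDist p) : mutualInfo p (delW d) ≤ blockCapacity n d :=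
  le_ciSup (f := fun p : {p : (Fin n → Bool) → ℝ // IsDist p} => mutualInfo p.1 (delW d))
    ⟨Real.logb 2 (Fintype.card (DelOut n)), by
      rintro _ ⟨p, rfl⟩
      exact mutualInfo_le_logb_card p.2 (delW_isDist hd)⟩ ⟨p, hp⟩

theorem blockCapacity_add_le {d : ℝ} (hd : d ∈ Set.Icc (0 : ℝ) 1) (a b : ℕ) :
    blockCapacity (a + b) d ≤ blockCapacity a d + blockCapacity b d := by
  refine ciSup_le fun ⟨p, hp⟩ => ?_
  have hp' := hp.comp_equiv (Fin.appendEquiv a b)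
  have hW := IsDist.prodChannel (delW_isDist (n := a) hd) (delW_isDist (n := b) hd)
  calc mutualInfo p (delW d)
      = mutualInfo (p ∘ Fin.appendEquiv a b)
          (mapChannel DelOut.append (prodChannel (delW (n := a) d) (delW (n := b) d))) := by
        rw [← delW_append, mutualInfo_comp_equiv]
    _ ≤ mutualInfo (p ∘ Fin.appendEquiv a b) (prodChannel (delW (n := a) d) (delW (n := b) d)) :=
        mutualInfo_mapChannel_le _ hp'.1 fun x => (hW x).1
    _ ≤ _ := mutualInfo_prodChannel_le hp' (delW_isDist hd) (delW_isDist hd)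
    _ ≤ _ := add_le_add (mutualInfo_le_blockCapacity hd hp'.marginal_fst)
        (mutualInfo_le_blockCapacity hd hp'.marginal_snd)

theorem le_blockCapacity_add {d : ℝ} (hd : d ∈ Set.Icc (0 : ℝ) 1) (a b : ℕ) :
    blockCapacity a d + blockCapacity b d ≤ blockCapacity (a + b) d + Real.logb 2 (b + 1) := by
  refine ciSup_add_ciSup_le fun ⟨p, hp⟩ ⟨p', hp'⟩ => ?_
  have hW := IsDist.prodChannel (delW_isDist (n := a) hd) (delW_isDist (n := b) hd)
  have hpp := hp.prod hp'
  set r := fun x : (Fin a → Bool) × (Fin b → Bool) => p x.1 * p' x.2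
  have hr : (r ∘ (Fin.appendEquiv a b).symm) ∘ Fin.appendEquiv a b = r := by
    funext x
    simp
  have h := mutualInfo_le_mapChannel_add DelOut.append hpp hW (b + 1) DelOut.card_fiber_append_le
  rw [mutualInfo_prodChannel_of_indep hp hp' (delW_isDist hd) (delW_isDist hd), ← delW_append,
    ← hr, mutualInfo_comp_equiv] at h
  push_cast at h
  have := mutualInfo_le_blockCapacity hd (hpp.comp_equiv (Fin.appendEquiv a b).symm)
  linarith

theorem blockCapacity_mul_le {d : ℝ} (hd : d ∈ Set.Icc (0 : ℝ) 1) (m : ℕ) {k : ℕ} (hk : 1 ≤ k) :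
    blockCapacity (k * m) d ≤ k * blockCapacity m d := by
  induction k, hk using Nat.le_induction with
  | base => simp
  | succ k hk ih =>
    rw [Nat.succ_mul]
    have := blockCapacity_add_le hd (k * m) m
    push_cast
    linarith

theorem le_blockCapacity_mul {d : ℝ} (hd : d ∈ Set.Icc (0 : ℝ) 1) (n : ℕ) {k : ℕ} (hk : 1 ≤ k) :
    k * (blockCapacity n d - Real.logb 2 (n + 1)) ≤ blockCapacity (k * n) d := by
  induction k, hk using Nat.le_induction with
  | base =>
    have : 0 ≤ Real.logb 2 ((n : ℝ) + 1) :=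
      Real.logb_nonneg one_lt_two (by linarith [n.cast_nonneg (α := ℝ)])
    simpa using this
  | succ k hk ih =>
    rw [Nat.succ_mul]
    have := le_blockCapacity_add hd (k * n) n
    push_cast
    linarith

theorem Cn_sub_le_Cn {d : ℝ} (hd : d ∈ Set.Icc (0 : ℝ) 1) {n m : ℕ} (hn : 1 ≤ n) (hm : 1 ≤ m) :
    Cn n d - Real.logb 2 (n + 1) / n ≤ Cn m d := by
  have h1 := le_blockCapacity_mul hd n hm
  have h2 := blockCapacity_mul_le hd m hn
  rw [Nat.mul_comm n m] at h2
  have hn' : (0 : ℝ) < n := by exact_mod_cast hn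
  have hm' : (0 : ℝ) < m := by exact_mod_cast hm
  change 1 / (n : ℝ) * blockCapacity n d - _ ≤ 1 / (m : ℝ) * blockCapacity m d
  rw [one_div_mul_eq_div, one_div_mul_eq_div, ← sub_div, div_le_div_iff₀ hn' hm']
  linarith

/-- For every `d ∈ [0,1]` and every `n ≥ 1`,
`C_n(d) − log₂(n+1)/n ≤ C(d) ≤ C_n(d)`. -/
theorem C_between_Cn_bounds (d : ℝ) (hd : d ∈ Set.Icc (0 : ℝ) 1) (n : ℕ) (hn : 1 ≤ n) :
    Cn n d - Real.logb 2 (n + 1) / n ≤ C d ∧ C d ≤ Cn n d := by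
  have : Nonempty {m : ℕ // 1 ≤ m} := ⟨⟨1, le_rfl⟩⟩
  refine ⟨le_ciInf fun m => Cn_sub_le_Cn hd hn m.2, ?_⟩
  exact ciInf_le (f := fun m : {m : ℕ // 1 ≤ m} => Cn m d)
    ⟨Cn 1 d - Real.logb 2 ((1 : ℕ) + 1) / (1 : ℕ), by
      rintro _ ⟨m, rfl⟩
      exact Cn_sub_le_Cn hd le_rfl m.2⟩ ⟨n, hn⟩
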